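/- Let π₂(y₁,y₂) := (1 − y₁, y₂) be the reflection across the vertical line y₁ = 1/2. For every x ∈ S₀₁ = f₀(f₁(S)) and every d > √3/8, the point π₂(f₁(x)) lies in S₀₁ and μ(B(x,d)) ≤ 2^s · μ(B(π₂(f₁(x)), d/2)). -/

import Mathlib

open MeasureTheory Metric Set
open scoped ENNReal

noncomputable section

/-- The point `(a, b)` of the Euclidean plane. -/
def pt (a b : ℝ) : EuclideanSpace ℝ (Fin 2) := (WithLp.equiv 2 (Fin 2 → ℝ)).symm ![a, b]

/-- The translation vectors of the three similitudes. -/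
def v : Fin 3 → EuclideanSpace ℝ (Fin 2)
  | 0 => pt 0 0
  | 1 => pt (1/2) 0
  | 2 => pt (1/4) (Real.sqrt 3 / 4)

/-- The three similitudes generating the Sierpinski gasket. -/
def f (i : Fin 3) (x : EuclideanSpace ℝ (Fin 2)) : EuclideanSpace ℝ (Fin 2) :=
  (1/2 : ℝ) • x + v i

/-- `fword [i₁, …, i_k] = f_{i₁} ∘ ⋯ ∘ f_{i_k}`. -/
def fword : List (Fin 3) → EuclideanSpace ℝ (Fin 2) → EuclideanSpace ℝ (Fin 2)
  | [] => id
  | i :: l => f i ∘ fword l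

/-- The similarity dimension `s = log 3 / log 2`. -/
def sDim : ℝ := Real.log 3 / Real.log 2

/-- The normalised Hausdorff measure `μ = H^s(S)⁻¹ • H^s⌊S`. -/
def muS (S : Set (EuclideanSpace ℝ (Fin 2))) : Measure (EuclideanSpace ℝ (Fin 2)) :=
  (μH[sDim] S)⁻¹ • (μH[sDim]).restrict S

/-- Fixed points `z_i = 2 v_i`. -/
def z (i : Fin 3) : EuclideanSpace ℝ (Fin 2) := (2 : ℝ) • v i

/-- The Hutchinson operator. -/
def Fop (A : Set (EuclideanSpace ℝ (Fin 2))) : Set (EuclideanSpace ℝ (Fin 2)) :=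
  f 0 '' A ∪ f 1 '' A ∪ f 2 '' A

/-- The discrete approximations `A_k = F^{k-1}(A₁)`, `A₁ = {z₀, z₁, z₂}`. -/
def Aset (k : ℕ) : Set (EuclideanSpace ℝ (Fin 2)) := Fop^[k - 1] {z 0, z 1, z 2}

/-- The discrete measures `μ_k`. -/
def muk (k : ℕ) : Measure (EuclideanSpace ℝ (Fin 2)) :=
  ((3 : ℝ≥0∞)⁻¹ ^ k) • ∑ i : Fin (k - 1) → Fin 3,
    (Measure.dirac (fword (List.ofFn i) (z 0)) + Measure.dirac (fword (List.ofFn i) (z 1)) +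
      Measure.dirac (fword (List.ofFn i) (z 2)))

/-- The centred Hausdorff premeasure `C₀^s(A)` (the limit as `δ → 0⁺` is written as a
supremum over `δ > 0`, the inner infimum being antitone in `δ`). -/
def centredPremeasure (s : ℝ) (A : Set (EuclideanSpace ℝ (Fin 2))) : ℝ≥0∞ :=
  ⨆ (δ : ℝ) (_ : 0 < δ),
    ⨅ (x : ℕ → EuclideanSpace ℝ (Fin 2)) (d : ℕ → ℝ) (_ : ∀ n, x n ∈ A)
      (_ : ∀ n, 0 ≤ d n) (_ : ∀ n, 2 * d n ≤ δ) (_ : A ⊆ ⋃ n, closedBall (x n) (d n)),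
      ∑' n, ENNReal.ofReal ((2 * d n) ^ s)

/-- The reflection across the vertical line `x₁ = 1/2`. -/
def refl2 (x : EuclideanSpace ℝ (Fin 2)) : EuclideanSpace ℝ (Fin 2) := pt (1 - x 0) (x 1)

/-- The reflection across the vertical line `x₁ = 1/4`. -/
def refl4 (x : EuclideanSpace ℝ (Fin 2)) : EuclideanSpace ℝ (Fin 2) := pt (1/2 - x 0) (x 1)

theorem refl2_f_zero (p : EuclideanSpace ℝ (Fin 2)) : refl2 (f 0 p) = f 1 (refl2 p) := by
  ext i
  fin_cases i <;> simp [refl2, f, v, pt] <;> ring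

theorem refl2_f_one (p : EuclideanSpace ℝ (Fin 2)) : refl2 (f 1 p) = f 0 (refl2 p) := by
  ext i
  fin_cases i <;> simp [refl2, f, v, pt] <;> ring

theorem refl2_f_two (p : EuclideanSpace ℝ (Fin 2)) : refl2 (f 2 p) = f 2 (refl2 p) := by
  ext i
  fin_cases i <;> simp [refl2, f, v, pt] <;> ring

theorem isometry_refl2 : Isometry refl2 := by
  refine Isometry.of_dist_eq fun p q => ?_
  simp only [EuclideanSpace.dist_eq, Fin.sum_univ_two, Real.dist_eq, sq_abs]
  congr 1
  simp [refl2, pt]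
  ring

theorem dist_f (i : Fin 3) (p q : EuclideanSpace ℝ (Fin 2)) :
    dist (f i p) (f i q) = dist p q / 2 := by
  rw [f, f, dist_add_right, dist_smul₀]
  norm_num
  ring

theorem mem_iff_of_eq_Fop {S : Set (EuclideanSpace ℝ (Fin 2))} (hS : S = Fop S)
    {p : EuclideanSpace ℝ (Fin 2)} : p ∈ S ↔ ∃ i, ∃ q ∈ S, f i q = p := by
  conv_lhs => rw [hS]
  simp [Fop, Fin.exists_fin_succ, or_assoc]

/-- A compact set invariant under the Hutchinson operator is contained in every nonempty compact
invariant set. -/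
theorem subset_of_eq_Fop {A B : Set (EuclideanSpace ℝ (Fin 2))} (hA : IsCompact A)
    (hB : IsCompact B) (hBne : B.Nonempty) (hAF : A = Fop A) (hBF : B = Fop B) : A ⊆ B := by
  rcases A.eq_empty_or_nonempty with rfl | hAne
  · exact empty_subset _
  obtain ⟨a, ha, hmax⟩ := hA.exists_isMaxOn hAne (continuous_infDist_pt B).continuousOn
  have hle : infDist a B ≤ 0 := by
    obtain ⟨i, a', ha', hfa⟩ := (mem_iff_of_eq_Fop hAF).1 ha
    obtain ⟨b, hb, hab⟩ := hB.exists_infDist_eq_dist hBne a'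
    have h₁ : infDist a B ≤ dist a (f i b) :=
      infDist_le_dist_of_mem ((mem_iff_of_eq_Fop hBF).2 ⟨i, b, hb, rfl⟩)
    have h₂ : infDist a' B ≤ infDist a B := hmax ha'
    rw [← hfa, dist_f, ← hab, hfa] at h₁
    linarith
  intro p hp
  have hp' : infDist p B ≤ infDist a B := hmax hp
  exact (hB.isClosed.mem_iff_infDist_zero hBne).2
    (le_antisymm (hp'.trans hle) infDist_nonneg)

theorem refl2_mem {S : Set (EuclideanSpace ℝ (Fin 2))} (hS : IsCompact S) (hSF : S = Fop S)
    {p : EuclideanSpace ℝ (Fin 2)} (hp : p ∈ S) : refl2 p ∈ S := by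
  refine subset_of_eq_Fop (hS.image isometry_refl2.continuous) hS ⟨p, hp⟩ ?_ hSF
    (mem_image_of_mem refl2 hp)
  conv_lhs => rw [hSF]
  simp only [Fop, image_union, image_image, refl2_f_zero, refl2_f_one, refl2_f_two]
  rw [union_comm (_ '' S) (_ '' S)]

theorem hausdorffMeasure_closedBall_inter_le {S : Set (EuclideanSpace ℝ (Fin 2))}
    (hS : IsCompact S) (hSF : S = Fop S) {s : ℝ} (hs : 0 ≤ s) (i : Fin 3)
    (x : EuclideanSpace ℝ (Fin 2)) (d : ℝ) :
    μH[s] (closedBall x d ∩ S) ≤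
      ENNReal.ofReal ((2 : ℝ) ^ s) * μH[s] (closedBall (refl2 (f i x)) (d / 2) ∩ S) := by
  have hdist (p q : EuclideanSpace ℝ (Fin 2)) :
      dist (refl2 (f i p)) (refl2 (f i q)) = dist p q / 2 := by
    rw [isometry_refl2.dist_eq, dist_f]
  have hanti : AntilipschitzWith 2 fun p => refl2 (f i p) := by
    refine AntilipschitzWith.of_le_mul_dist fun p q => ?_
    rw [hdist]
    norm_num
    linarith
  refine (hanti.le_hausdorffMeasure_image hs _).trans ?_
  rw [← ENNReal.ofReal_rpow_of_pos two_pos, ENNReal.ofReal_ofNat]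
  refine mul_le_mul_right (measure_mono ?_) _
  rintro _ ⟨p, ⟨hpx, hpS⟩, rfl⟩
  refine ⟨?_, refl2_mem hS hSF ((mem_iff_of_eq_Fop hSF).2 ⟨i, p, hpS, rfl⟩)⟩
  rw [mem_closedBall] at hpx ⊢
  rw [hdist]
  linarith

theorem sDim_nonneg : 0 ≤ sDim :=
  div_nonneg (Real.log_nonneg (by norm_num)) (Real.log_nonneg (by norm_num))

theorem statement8 (S : Set (EuclideanSpace ℝ (Fin 2))) (hScomp : IsCompact S) (hSne : S.Nonempty)
    (hSinv : S = f 0 '' S ∪ f 1 '' S ∪ f 2 '' S)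
    (hSpos : 0 < μH[sDim] S) (hSfin : μH[sDim] S < ⊤)
    (x : EuclideanSpace ℝ (Fin 2)) (hx : x ∈ fword [0, 1] '' S)
    (d : ℝ) (hd : Real.sqrt 3 / 8 < d) :
    refl2 (f 1 x) ∈ fword [0, 1] '' S ∧
      muS S (closedBall x d) ≤
        ENNReal.ofReal ((2 : ℝ) ^ sDim) * muS S (closedBall (refl2 (f 1 x)) (d / 2)) := by
  constructor
  · obtain ⟨p, hp, rfl⟩ := hx
    refine ⟨refl2 (f 1 p),
      refl2_mem hScomp hSinv ((mem_iff_of_eq_Fop hSinv).2 ⟨1, p, hp, rfl⟩), ?_⟩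
    simp only [fword, Function.comp_apply, id_eq, refl2_f_one, refl2_f_zero]
  · simp only [muS, Measure.smul_apply, smul_eq_mul,
      Measure.restrict_apply measurableSet_closedBall]
    rw [mul_left_comm]
    gcongr
    exact hausdorffMeasure_closedBall_inter_le hScomp hSinv sDim_nonneg 1 x d

end
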